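/- (Lemma 4.9, commutativity of the Hochschild–Chevalley bicomplex) Let G be a Gerstenhaber algebra, n ≥ 1, and f : G^n → G a k-multilinear map, homogeneous of degree f̃ and alternating (i.e. f(x₁,…,x_i,x_{i+1},…,x_n) = −(−1)^{(|x_i|−1)(|x_{i+1}|−1)} f(x₁,…,x_{i+1},x_i,…,x_n)). Then for all homogeneous x₁,…,x_{n+2} in G one has d_H^{n0}(d_CH f)(x₁,…,x_n; x_{n+1}, x_{n+2}) = d_CH^{n−1,1}(d_H^{n−1,0} f)(x₁,…,x_n; x_{n+1}, x_{n+2}), where d_CH, d_H^{n−1,0}, d_H^{n0}, and d_CH^{n−1,1} are defined by the formulas in the context. -/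

import Mathlib

/-- A Gerstenhaber bracket on a ℤ-graded (graded-commutative) associative unital
`k`-algebra `A` with grading `𝒜`: a `k`-bilinear bracket of degree `-1` satisfying
graded antisymmetry (G1), the graded Jacobi identity (G2) and the graded Leibniz
(odd Poisson) rule (G3); graded commutativity of the product is also recorded. -/
structure GerstenhaberBracket (k A : Type) [Field k] [CharZero k] [Ring A] [Algebra k A]
    (𝒜 : ℤ → Submodule k A) [GradedAlgebra 𝒜] where
  br : A →ₗ[k] A →ₗ[k] A
  br_mem : ∀ {i j : ℤ} {x y : A}, x ∈ 𝒜 i → y ∈ 𝒜 j → br x y ∈ 𝒜 (i + j - 1)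
  gcomm : ∀ {i j : ℤ} {x y : A}, x ∈ 𝒜 i → y ∈ 𝒜 j →
    x * y = ((-1 : k) ^ (i * j)) • (y * x)
  g1 : ∀ {i j : ℤ} {x y : A}, x ∈ 𝒜 i → y ∈ 𝒜 j →
    br x y = -(((-1 : k) ^ ((i - 1) * (j - 1))) • br y x)
  g2 : ∀ {i j l : ℤ} {x y z : A}, x ∈ 𝒜 i → y ∈ 𝒜 j → z ∈ 𝒜 l →
    br x (br y z) = br (br x y) z + ((-1 : k) ^ ((i - 1) * (j - 1))) • br y (br x z)
  g3 : ∀ {i j l : ℤ} {x y z : A}, x ∈ 𝒜 i → y ∈ 𝒜 j → z ∈ 𝒜 l →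
    br x (y * z) = br x y * z + ((-1 : k) ^ (j * (i - 1))) • (y * br x z)

open Finset

section Bicomplex

variable {k A : Type} [Field k] [CharZero k] [Ring A] [Algebra k A]

/-- Delete the entry at position `i` of an `ℕ`-indexed tuple. -/
def removeAt {α : Type} (i : ℕ) (a : ℕ → α) : ℕ → α :=
  fun p => if p < i then a p else a (p + 1)

/-- Delete the entries at positions `i < j` of an `ℕ`-indexed tuple. -/
def removeTwo {α : Type} (i j : ℕ) (a : ℕ → α) : ℕ → α :=
  fun p => if p < i then a p else if p + 1 < j then a (p + 1) else a (p + 2)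

/-- Prepend an entry at position `0` of an `ℕ`-indexed tuple. -/
def consAt {α : Type} (b : α) (a : ℕ → α) : ℕ → α :=
  fun p => if p = 0 then b else a (p - 1)

/-- The Chevalley differential (formula (4.2.2)) taking an alternating `n`-linear
cochain of degree `d` to an alternating `(n+1)`-linear cochain of degree `d − 1`.
A cochain is modelled as a function of the degree vector of its homogeneous
arguments and of the arguments themselves. -/
def dCHtop (br : A → A → A) (d : ℤ) (n : ℕ) (F : (ℕ → ℤ) → (ℕ → A) → A) :
    (ℕ → ℤ) → (ℕ → A) → A := fun deg x =>
  (∑ i ∈ Finset.range (n + 1),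
      ((-1 : k) ^ ((i : ℤ) + (deg i - 1) * (d + n - 1 + ∑ p ∈ Finset.range i, (deg p - 1)))) •
        br (x i) (F (removeAt i deg) (removeAt i x)))
  + ∑ j ∈ Finset.range (n + 1), ∑ i ∈ Finset.range j,
      ((-1 : k) ^ ((i : ℤ) + (j : ℤ) + (deg i - 1) * (∑ p ∈ Finset.range i, (deg p - 1))
          + (deg j - 1) * (∑ q ∈ (Finset.range j).erase i, (deg q - 1)))) •
        F (consAt (deg i + deg j - 1) (removeTwo i j deg))
          (consAt (br (x i) (x j)) (removeTwo i j x))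

/-- The vertical Hochschild differential (formula of 4.8) taking an alternating
`(m+1)`-linear cochain `h` of degree `hd` to a cochain with `m` alternating
arguments and two further arguments (i.e. `m+2` arguments in total). -/
def dHvert (hd : ℤ) (m : ℕ) (H : (ℕ → ℤ) → (ℕ → A) → A) :
    (ℕ → ℤ) → (ℕ → A) → A := fun deg x =>
  ((-1 : k) ^ (deg m * (hd + (∑ p ∈ Finset.range m, deg p) + 1)
        + hd + ∑ p ∈ Finset.range m, deg p)) •
      (x m * H (Function.update deg m (deg (m + 1))) (Function.update x m (x (m + 1))))
  + ((-1 : k) ^ (hd + (∑ p ∈ Finset.range (m + 1), deg p) + 1)) •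
      H (Function.update deg m (deg m + deg (m + 1)))
        (Function.update x m (x m * x (m + 1)))
  + ((-1 : k) ^ (hd + ∑ p ∈ Finset.range (m + 1), deg p)) • (H deg x * x (m + 1))

/-- The first-line Chevalley differential (formula (4.5.1)) taking a cochain `g` of
degree `gd` with `n − 1` alternating arguments and two further arguments to a cochain
with `n` alternating arguments and two further arguments. -/
def dCHline (br : A → A → A) (gd : ℤ) (n : ℕ) (Gg : (ℕ → ℤ) → (ℕ → A) → A) :
    (ℕ → ℤ) → (ℕ → A) → A := fun deg x =>
  (∑ i ∈ Finset.range n,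
      ((-1 : k) ^ ((i : ℤ) + (deg i - 1) * (gd + n + ∑ p ∈ Finset.range i, (deg p - 1)))) •
        br (x i) (Gg (removeAt i deg) (removeAt i x)))
  - (∑ i ∈ Finset.range n,
      ((-1 : k) ^ ((i : ℤ) + (deg i - 1) * (∑ p ∈ Finset.Ico (i + 1) n, (deg p - 1)))) •
        Gg (Function.update (removeAt i deg) (n - 1) (deg i + deg n - 1))
          (Function.update (removeAt i x) (n - 1) (br (x i) (x n))))
  - (∑ i ∈ Finset.range n,
      ((-1 : k) ^ ((i : ℤ) + (deg i - 1) * (∑ p ∈ Finset.Ico (i + 1) (n + 1), (deg p - 1)))) •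
        Gg (Function.update (removeAt i deg) n (deg i + deg (n + 1) - 1))
          (Function.update (removeAt i x) n (br (x i) (x (n + 1)))))
  + ∑ j ∈ Finset.range n, ∑ i ∈ Finset.range j,
      ((-1 : k) ^ ((i : ℤ) + (j : ℤ) + (deg i - 1) * (∑ p ∈ Finset.range i, (deg p - 1))
          + (deg j - 1) * (∑ q ∈ (Finset.range j).erase i, (deg q - 1)))) •
        Gg (consAt (deg i + deg j - 1) (removeTwo i j deg))
          (consAt (br (x i) (x j)) (removeTwo i j x))

end Bicomplex


section Helpers

set_option linter.unusedSectionVars false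

variable {k A : Type} [Field k] [CharZero k] [Ring A] [Algebra k A]

lemma sgn_eq {a b : ℤ} (h : Even (a + b)) : (-1 : k) ^ a = (-1 : k) ^ b := by
  rcases Int.even_or_odd a with ha | ha
  · have hb : Even b := by rw [Int.even_add] at h; exact h.mp ha
    rw [ha.neg_one_zpow, hb.neg_one_zpow]
  · have hb : Odd b := by
      rw [Int.even_add] at h
      rw [← Int.not_even_iff_odd] at ha ⊢
      exact fun hb => ha (h.mpr hb)
    rw [ha.neg_one_zpow, hb.neg_one_zpow]

lemma sgn_mul (a b : ℤ) : (-1 : k) ^ a * (-1 : k) ^ b = (-1 : k) ^ (a + b) :=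
  (zpow_add₀ (by simp) a b).symm

lemma sgn_neg (a : ℤ) : -((-1 : k) ^ a) = (-1 : k) ^ (a + 1) := by
  rw [zpow_add₀ (by simp)]; simp

/-- Insert an entry at position `j`. -/
def insAt {α : Type} (j : ℕ) (b : α) (a : ℕ → α) : ℕ → α :=
  fun p => if p < j then a p else if p = j then b else a (p - 1)

lemma insAt_swap {α : Type} (j : ℕ) (b : α) (a : ℕ → α) :
    insAt j b a ∘ Equiv.swap j (j + 1) = insAt (j + 1) b a := by
  funext p
  simp only [Function.comp, Equiv.swap_apply_def, insAt]
  split_ifs <;> first | rfl | omega | (subst_vars; simp_all)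

lemma rotate (n : ℕ) (F : (ℕ → ℤ) → (ℕ → A) → A)
    (halt : ∀ (q : ℕ), q + 1 < n → ∀ (deg : ℕ → ℤ) (a : ℕ → A),
      F deg a = -(((-1 : k) ^ ((deg q - 1) * (deg (q + 1) - 1))) •
        F (deg ∘ Equiv.swap q (q + 1)) (a ∘ Equiv.swap q (q + 1))))
    (b : ℤ) (v : A) (deg : ℕ → ℤ) (x : ℕ → A) (j : ℕ) (hj : j < n) :
    F (consAt b deg) (consAt v x)
      = ((-1 : k) ^ ((j : ℤ) + (b - 1) * ∑ p ∈ Finset.range j, (deg p - 1))) •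
        F (insAt j b deg) (insAt j v x) := by
  induction j with
  | zero =>
    have h : ∀ {α : Type} (b : α) (a : ℕ → α), consAt b a = insAt 0 b a := by
      intro α b a; funext p; simp [consAt, insAt]
    simp [h]
  | succ j ih =>
    rw [ih (by omega), halt j hj, insAt_swap, insAt_swap, ← neg_smul, smul_smul]
    congr 1
    rw [sgn_neg, sgn_mul]
    apply sgn_eq
    have h1 : insAt j b deg j = b := by simp [insAt]
    have h2 : insAt j b deg (j + 1) = deg j := by simp [insAt]
    rw [h1, h2, Finset.sum_range_succ]
    push_cast
    generalize ∑ p ∈ Finset.range j, (deg p - 1) = S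
    exact ⟨j + (b - 1) * S + (b - 1) * (deg j - 1) + 1, by ring⟩

/-- The cochain with the argument `i` removed and the last argument replaced. -/
def Tf (F : (ℕ → ℤ) → (ℕ → A) → A) (m : ℕ) (deg : ℕ → ℤ) (x : ℕ → A) (i : ℕ) (dv : ℤ) (v : A) : A :=
  F (Function.update (removeAt i deg) m dv) (Function.update (removeAt i x) m v)

/-- The cochain with first argument `c` and last argument replaced. -/
def Uf (F : (ℕ → ℤ) → (ℕ → A) → A) (m : ℕ) (deg : ℕ → ℤ) (x : ℕ → A) (i j : ℕ) (dc : ℤ) (c : A)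
    (dv : ℤ) (v : A) : A :=
  F (Function.update (consAt dc (removeTwo i j deg)) m dv)
    (Function.update (consAt c (removeTwo i j x)) m v)

lemma removeAt_update {α : Type} (i m : ℕ) (hi : i ≤ m) (a : ℕ → α) (v : α) :
    removeAt i (Function.update a (m + 1) v) = Function.update (removeAt i a) m v := by
  funext p
  simp only [removeAt, Function.update_apply]
  split_ifs <;> first | rfl | omega

lemma removeTwo_update {α : Type} (i j m : ℕ) (hi : i < j) (hj : j ≤ m) (c : α) (a : ℕ → α) (v : α) :
    consAt c (removeTwo i j (Function.update a (m + 1) v))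
      = Function.update (consAt c (removeTwo i j a)) m v := by
  funext p
  simp only [consAt, removeTwo, Function.update_apply]
  split_ifs <;> first | rfl | omega

lemma sum_update_lt (deg : ℕ → ℤ) (m j : ℕ) (hj : j ≤ m) (v : ℤ) (s : Finset ℕ) (hs : s ⊆ Finset.range j) :
    ∑ p ∈ s, (Function.update deg m v p - 1) = ∑ p ∈ s, (deg p - 1) := by
  refine Finset.sum_congr rfl fun p hp => ?_
  have := Finset.mem_range.mp (hs hp)
  rw [Function.update_of_ne (by omega)]

lemma sum_split (g : ℕ → ℤ) (i n : ℕ) (hi : i < n) :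
    ∑ p ∈ Finset.range n, g p
      = ∑ p ∈ Finset.range i, g p + g i + ∑ p ∈ Finset.Ico (i + 1) n, g p := by
  rw [← Finset.sum_range_succ, Finset.sum_range_add_sum_Ico _ (by omega)]

lemma sum_erase (g : ℕ → ℤ) (i n : ℕ) (hi : i < n) :
    ∑ p ∈ (Finset.range n).erase i, g p
      = ∑ p ∈ Finset.range i, g p + ∑ p ∈ Finset.Ico (i + 1) n, g p := by
  have := Finset.sum_erase_add (Finset.range n) g (Finset.mem_range.mpr hi)
  rw [sum_split g i n hi] at this
  linarith

lemma sum_removeAt (g : ℕ → ℤ) (i m : ℕ) (hi : i ≤ m) :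
    ∑ p ∈ Finset.range m, removeAt i g p
      = ∑ p ∈ Finset.range i, g p + ∑ p ∈ Finset.Ico (i + 1) (m + 1), g p := by
  rw [← Finset.sum_range_add_sum_Ico _ hi, ← Finset.sum_Ico_add' g i m 1]
  congr 1
  · refine Finset.sum_congr rfl fun p hp => ?_
    rw [removeAt, if_pos (Finset.mem_range.mp hp)]
  · refine Finset.sum_congr rfl fun p hp => ?_
    rw [removeAt, if_neg (by have := Finset.mem_Ico.mp hp; omega)]

lemma top_expand (m : ℕ) (d : ℤ) (br : A → A → A) (F : (ℕ → ℤ) → (ℕ → A) → A)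
    (hdep : ∀ (deg deg' : ℕ → ℤ) (a a' : ℕ → A),
      (∀ p, p < m + 1 → deg p = deg' p ∧ a p = a' p) → F deg a = F deg' a')
    (halt : ∀ (q : ℕ), q + 1 < m + 1 → ∀ (deg : ℕ → ℤ) (a : ℕ → A),
      F deg a = -(((-1 : k) ^ ((deg q - 1) * (deg (q + 1) - 1))) •
        F (deg ∘ Equiv.swap q (q + 1)) (a ∘ Equiv.swap q (q + 1))))
    (deg : ℕ → ℤ) (x : ℕ → A) (dv : ℤ) (v : A) :
    dCHtop (k := k) br d (m + 1) F (Function.update deg (m + 1) dv) (Function.update x (m + 1) v)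
    = (∑ i ∈ Finset.range (m + 1),
        (((-1 : k) ^ ((i : ℤ) + (deg i - 1) * (d + m + ∑ p ∈ Finset.range i, (deg p - 1)))) •
          br (x i) (Tf F m deg x i dv v)
        + ((-1 : k) ^ ((i : ℤ) + 1 + (deg i - 1) * (∑ p ∈ Finset.Ico (i + 1) (m + 1), (deg p - 1)))) •
          Tf F m deg x i (deg i + dv - 1) (br (x i) v)))
      + (∑ j ∈ Finset.range (m + 1), ∑ i ∈ Finset.range j,
      ((-1 : k) ^ ((i : ℤ) + (j : ℤ) + (deg i - 1) * (∑ p ∈ Finset.range i, (deg p - 1))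
          + (deg j - 1) * (∑ q ∈ (Finset.range j).erase i, (deg q - 1)))) •
        Uf F m deg x i j (deg i + deg j - 1) (br (x i) (x j)) dv v)
      + ((-1 : k) ^ ((m : ℤ) + 1 + (dv - 1) * (d + m + ∑ p ∈ Finset.range (m + 1), (deg p - 1)))) •
          br v (F deg x) := by
  unfold dCHtop
  rw [Finset.sum_range_succ _ (m + 1), Finset.sum_range_succ _ (m + 1), Finset.sum_add_distrib]
  have e1 : ∀ i ∈ Finset.range (m + 1),
      ((-1 : k) ^ ((i : ℤ) + (Function.update deg (m + 1) dv i - 1) * (d + (m + 1 : ℕ) - 1 +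
          ∑ p ∈ Finset.range i, (Function.update deg (m + 1) dv p - 1)))) •
        br (Function.update x (m + 1) v i) (F (removeAt i (Function.update deg (m + 1) dv))
          (removeAt i (Function.update x (m + 1) v)))
      = ((-1 : k) ^ ((i : ℤ) + (deg i - 1) * (d + m + ∑ p ∈ Finset.range i, (deg p - 1)))) •
          br (x i) (Tf F m deg x i dv v) := by
    intro i hi
    rw [Finset.mem_range] at hi
    rw [sum_update_lt deg (m + 1) i (by omega) dv _ subset_rfl, removeAt_update i m (by omega),
      removeAt_update i m (by omega), Function.update_of_ne (by omega), Function.update_of_ne (by omega)]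
    congr 3
    push_cast; ring
  have e2 : ∀ j ∈ Finset.range (m + 1), ∀ i ∈ Finset.range j,
      ((-1 : k) ^ ((i : ℤ) + (j : ℤ) + (Function.update deg (m + 1) dv i - 1) *
            (∑ p ∈ Finset.range i, (Function.update deg (m + 1) dv p - 1))
          + (Function.update deg (m + 1) dv j - 1) *
            (∑ q ∈ (Finset.range j).erase i, (Function.update deg (m + 1) dv q - 1)))) •
        F (consAt (Function.update deg (m + 1) dv i + Function.update deg (m + 1) dv j - 1)
            (removeTwo i j (Function.update deg (m + 1) dv)))
          (consAt (br (Function.update x (m + 1) v i) (Function.update x (m + 1) v j))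
            (removeTwo i j (Function.update x (m + 1) v)))
      = ((-1 : k) ^ ((i : ℤ) + (j : ℤ) + (deg i - 1) * (∑ p ∈ Finset.range i, (deg p - 1))
          + (deg j - 1) * (∑ q ∈ (Finset.range j).erase i, (deg q - 1)))) •
        Uf F m deg x i j (deg i + deg j - 1) (br (x i) (x j)) dv v := by
    intro j hj i hi
    rw [Finset.mem_range] at hi hj
    rw [sum_update_lt deg (m + 1) i (by omega) dv _ subset_rfl,
      sum_update_lt deg (m + 1) j (by omega) dv _ (Finset.erase_subset _ _),
      removeTwo_update i j m hi (by omega), removeTwo_update i j m hi (by omega),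
      Function.update_of_ne (a := i) (by omega), Function.update_of_ne (a := j) (by omega),
      Function.update_of_ne (a := i) (by omega), Function.update_of_ne (a := j) (by omega)]
    rfl
  have e3 : ∀ i ∈ Finset.range (m + 1),
      ((-1 : k) ^ ((i : ℤ) + ((m + 1 : ℕ) : ℤ) + (Function.update deg (m + 1) dv i - 1) *
            (∑ p ∈ Finset.range i, (Function.update deg (m + 1) dv p - 1))
          + (Function.update deg (m + 1) dv (m + 1) - 1) *
            (∑ q ∈ (Finset.range (m + 1)).erase i, (Function.update deg (m + 1) dv q - 1)))) •
        F (consAt (Function.update deg (m + 1) dv i + Function.update deg (m + 1) dv (m + 1) - 1)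
            (removeTwo i (m + 1) (Function.update deg (m + 1) dv)))
          (consAt (br (Function.update x (m + 1) v i) (Function.update x (m + 1) v (m + 1)))
            (removeTwo i (m + 1) (Function.update x (m + 1) v)))
      = ((-1 : k) ^ ((i : ℤ) + 1 + (deg i - 1) * (∑ p ∈ Finset.Ico (i + 1) (m + 1), (deg p - 1)))) •
          Tf F m deg x i (deg i + dv - 1) (br (x i) v) := by
    intro i hi
    rw [Finset.mem_range] at hi
    rw [sum_update_lt deg (m + 1) i (by omega) dv _ subset_rfl,
      sum_update_lt deg (m + 1) (m + 1) (by omega) dv _ (Finset.erase_subset _ _),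
      Function.update_of_ne (a := i) (by omega), Function.update_of_ne (a := i) (by omega),
      Function.update_self, Function.update_self, rotate (k := k) (m + 1) F halt _ _ _ _ m (by omega),
      smul_smul, sgn_mul]
    have hR : ∀ {α : Type} (a : ℕ → α) (u : α) (p : ℕ), p < m →
        removeTwo i (m + 1) (Function.update a (m + 1) u) p = removeAt i a p := by
      intro α a u p hp
      simp only [removeTwo, removeAt, Function.update_apply]
      split_ifs <;> first | rfl | omega
    have hI : ∀ {α : Type} (a : ℕ → α) (u w : α) (p : ℕ), p < m + 1 →
        insAt m w (removeTwo i (m + 1) (Function.update a (m + 1) u)) p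
          = Function.update (removeAt i a) m w p := by
      intro α a u w p hp
      simp only [insAt, Function.update_apply]
      split_ifs with h1 h2
      · omega
      · exact hR a u p h1
      · rfl
      · omega
    rw [Tf, hdep _ _ _ _ (fun p hp => ⟨hI deg dv _ p hp, hI x v _ p hp⟩)]
    congr 1
    apply sgn_eq
    have hs : ∑ p ∈ Finset.range m, (removeTwo i (m + 1) (Function.update deg (m + 1) dv) p - 1)
        = ∑ p ∈ Finset.range i, (deg p - 1) + ∑ p ∈ Finset.Ico (i + 1) (m + 1), (deg p - 1) := by
      rw [← sum_removeAt (fun p => deg p - 1) i m (by omega)]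
      refine Finset.sum_congr rfl fun p hp => ?_
      rw [hR deg dv p (Finset.mem_range.mp hp)]
      simp only [removeAt]; split_ifs <;> rfl
    rw [hs, sum_erase _ i (m + 1) hi]
    generalize ∑ p ∈ Finset.range i, (deg p - 1) = S
    generalize ∑ p ∈ Finset.Ico (i + 1) (m + 1), (deg p - 1) = T
    push_cast
    exact ⟨i + m + 1 + (deg i - 1) * S + (dv - 1) * (S + T) + (deg i - 1) * T, by ring⟩
  rw [Finset.sum_congr rfl e1, Finset.sum_congr rfl e3,
    Finset.sum_congr rfl (fun j hj => Finset.sum_congr rfl (e2 j hj))]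
  have e4 : br (Function.update x (m + 1) v (m + 1)) (F (removeAt (m + 1) (Function.update deg (m + 1) dv))
          (removeAt (m + 1) (Function.update x (m + 1) v))) = br v (F deg x) := by
    rw [Function.update_self]
    congr 1
    apply hdep
    intro p hp
    simp only [removeAt, if_pos hp]
    rw [Function.update_of_ne (by omega), Function.update_of_ne (by omega)]
    exact ⟨rfl, rfl⟩
  rw [e4, Function.update_self, sum_update_lt deg (m + 1) (m + 1) le_rfl dv _ subset_rfl]
  have e5 : d + ((m + 1 : ℕ) : ℤ) - 1 + ∑ p ∈ Finset.range (m + 1), (deg p - 1)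
    = d + m + ∑ p ∈ Finset.range (m + 1), (deg p - 1) := by push_cast; ring
  rw [e5]
  push_cast
  abel


lemma dHvert_F (m : ℕ) (d : ℤ) (F : (ℕ → ℤ) → (ℕ → A) → A)
    (hdep : ∀ (deg deg' : ℕ → ℤ) (a a' : ℕ → A),
      (∀ p, p < m + 1 → deg p = deg' p ∧ a p = a' p) → F deg a = F deg' a')
    (E D : ℕ → ℤ) (X Y : ℕ → A) (dy dz : ℤ) (y z : A)
    (hE : ∀ p, p < m → E p = D p) (hX : ∀ p, p < m → X p = Y p)
    (hEm : E m = dy) (hXm : X m = y) (hEn : E (m + 1) = dz) (hXn : X (m + 1) = z) :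
    dHvert (k := k) d m F E X
      = ((-1 : k) ^ (dy * (d + (∑ p ∈ Finset.range m, D p) + 1) + d + ∑ p ∈ Finset.range m, D p)) •
          (y * F (Function.update D m dz) (Function.update Y m z))
        + ((-1 : k) ^ (d + ((∑ p ∈ Finset.range m, D p) + dy) + 1)) •
          F (Function.update D m (dy + dz)) (Function.update Y m (y * z))
        + ((-1 : k) ^ (d + ((∑ p ∈ Finset.range m, D p) + dy))) •
          (F (Function.update D m dy) (Function.update Y m y) * z) := by
  have hS : ∑ p ∈ Finset.range m, E p = ∑ p ∈ Finset.range m, D p :=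
    Finset.sum_congr rfl fun p hp => hE p (Finset.mem_range.mp hp)
  have hu : ∀ {α : Type} (a b : ℕ → α) (u : α), (∀ p, p < m → a p = b p) → ∀ p, p < m + 1 →
      Function.update a m u p = Function.update b m u p := by
    intro α a b u h p hp
    simp only [Function.update_apply]
    split_ifs with h1
    · rfl
    · exact h p (by omega)
  have h1 : ∀ u w, F (Function.update E m u) (Function.update X m w)
      = F (Function.update D m u) (Function.update Y m w) := fun u w =>
    hdep _ _ _ _ fun p hp => ⟨hu _ _ _ hE p hp, hu _ _ _ hX p hp⟩
  have h2 : F E X = F (Function.update D m dy) (Function.update Y m y) := by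
    rw [← h1, ← hEm, ← hXm, Function.update_eq_self, Function.update_eq_self]
  unfold dHvert
  rw [Finset.sum_range_succ, hS, h1, h1, h2, hEm, hXm, hEn, hXn]

lemma even_of_zmod (a : ℤ) (h : (a : ZMod 2) = 0) : Even a :=
  (ZMod.intCast_eq_zero_iff_even).mp h

lemma zmod_idem (a : ZMod 2) : a * a = a := by revert a; decide

lemma termA {𝒜 : ℤ → Submodule k A} [GradedAlgebra 𝒜] (G : GerstenhaberBracket k A 𝒜)
    (a b c d m i p q : ℤ) (x y z : A) (hx : x ∈ 𝒜 a) (hy : y ∈ 𝒜 b) (hz : z ∈ 𝒜 c)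
    (T : ℤ → A → A) (hadd : ∀ e u v, T e (u + v) = T e u + T e v)
    (hsmul : ∀ e (s : k) u, T e (s • u) = s • T e u)
    (hTy : T b y ∈ 𝒜 (p + q + m + b + d)) (hTz : T c z ∈ 𝒜 (p + q + m + c + d)) :
    ((-1 : k) ^ (b * (d - 1 + (p + q + a + m) + 1) + (d - 1) + (p + q + a + m))) •
      (y * (((-1 : k) ^ (i + (a - 1) * (d + m + p))) • G.br x (T c z)
        + ((-1 : k) ^ (i + 1 + (a - 1) * q)) • T (a + c - 1) (G.br x z)))
    + ((-1 : k) ^ (d - 1 + (p + q + a + m + b) + 1)) •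
      (((-1 : k) ^ (i + (a - 1) * (d + m + p))) • G.br x (T (b + c) (y * z))
        + ((-1 : k) ^ (i + 1 + (a - 1) * q)) • T (a + (b + c) - 1) (G.br x (y * z)))
    + ((-1 : k) ^ (d - 1 + (p + q + a + m + b))) •
      ((((-1 : k) ^ (i + (a - 1) * (d + m + p))) • G.br x (T b y)
        + ((-1 : k) ^ (i + 1 + (a - 1) * q)) • T (a + b - 1) (G.br x y)) * z)
    = ((-1 : k) ^ (i + (a - 1) * (d + (m + 1) + p))) •
        G.br x (((-1 : k) ^ (b * (d + (p + q + m) + 1) + d + (p + q + m))) • (y * T c z)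
          + ((-1 : k) ^ (d + (p + q + m + b) + 1)) • T (b + c) (y * z)
          + ((-1 : k) ^ (d + (p + q + m + b))) • (T b y * z))
      - ((-1 : k) ^ (i + (a - 1) * q)) •
        (((-1 : k) ^ ((a + b - 1) * (d + (p + q + m) + 1) + d + (p + q + m))) • (G.br x y * T c z)
          + ((-1 : k) ^ (d + (p + q + m + (a + b - 1)) + 1)) • T (a + b - 1 + c) (G.br x y * z)
          + ((-1 : k) ^ (d + (p + q + m + (a + b - 1)))) • (T (a + b - 1) (G.br x y) * z))
      - ((-1 : k) ^ (i + (a - 1) * (q + (b - 1)))) •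
        (((-1 : k) ^ (b * (d + (p + q + m) + 1) + d + (p + q + m))) •
            (y * T (a + c - 1) (G.br x z))
          + ((-1 : k) ^ (d + (p + q + m + b) + 1)) • T (b + (a + c - 1)) (y * G.br x z)
          + ((-1 : k) ^ (d + (p + q + m + b))) • (T b y * G.br x z)) := by
  have d1 : a + b - 1 + c = a + (b + c) - 1 := by ring
  have d2 : b + (a + c - 1) = a + (b + c) - 1 := by ring
  rw [d1, d2, G.g3 hx hy hz]
  simp only [map_add, map_smul]
  rw [G.g3 hx hy hTz, G.g3 hx hTy hz]
  simp only [hadd, hsmul, mul_add, add_mul, smul_add, smul_smul, mul_smul_comm, smul_mul_assoc, sgn_mul]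
  have ev : ∀ e f : ℤ, ((e + f : ℤ) : ZMod 2) = 0 → (-1 : k) ^ e = (-1 : k) ^ f :=
    fun e f h => sgn_eq (even_of_zmod _ h)
  have i1 := zmod_idem (a : ZMod 2)
  have i2 := zmod_idem (b : ZMod 2)
  have i3 := zmod_idem (m : ZMod 2)
  match_scalars <;> simp only [mul_one, sgn_neg]
  all_goals try refine (sub_eq_zero.mpr ?_).symm
  all_goals refine ev _ _ ?_
  all_goals push_cast
  all_goals grind

lemma termB (b d e : ℤ) (S S' : ℤ) (hS : S' = S - 1) (y z u1 u2 u3 : A) :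
    ((-1 : k) ^ (b * (d - 1 + S + 1) + (d - 1) + S)) • (y * ((-1 : k) ^ e • u1))
    + ((-1 : k) ^ (d - 1 + (S + b) + 1)) • ((-1 : k) ^ e • u2)
    + ((-1 : k) ^ (d - 1 + (S + b))) • (((-1 : k) ^ e • u3) * z)
    = (-1 : k) ^ e • (((-1 : k) ^ (b * (d + S' + 1) + d + S')) • (y * u1)
      + ((-1 : k) ^ (d + (S' + b) + 1)) • u2
      + ((-1 : k) ^ (d + (S' + b))) • (u3 * z)) := by
  subst hS
  simp only [smul_add, smul_smul, mul_smul_comm, smul_mul_assoc, sgn_mul]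
  congr 1
  · congr 1
    · congr 2; ring
    · congr 2; ring
  · congr 2; ring

lemma termC {𝒜 : ℤ → Submodule k A} [GradedAlgebra 𝒜] (G : GerstenhaberBracket k A 𝒜)
    (b c d m S : ℤ) (y z w : A) (hy : y ∈ 𝒜 b) (hz : z ∈ 𝒜 c) (hw : w ∈ 𝒜 (S + d)) :
    ((-1 : k) ^ (b * (d - 1 + S + 1) + (d - 1) + S)) •
      (y * (((-1 : k) ^ (m + 1 + (c - 1) * (d + m + (S - (m + 1))))) • G.br z w))
    + ((-1 : k) ^ (d - 1 + (S + b) + 1)) •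
      (((-1 : k) ^ (m + 1 + (b + c - 1) * (d + m + (S - (m + 1))))) • G.br (y * z) w)
    + ((-1 : k) ^ (d - 1 + (S + b))) •
      ((((-1 : k) ^ (m + 1 + (b - 1) * (d + m + (S - (m + 1))))) • G.br y w) * z) = 0 := by
  have hyz : y * z ∈ 𝒜 (b + c) := SetLike.mul_mem_graded hy hz
  rw [G.g1 hyz hw, G.g1 hy hw, G.g1 hz hw, G.g3 hw hy hz]
  simp only [← neg_smul, mul_add, add_mul, smul_add, smul_smul, mul_smul_comm, smul_mul_assoc, sgn_mul,
    sgn_neg]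
  have ev : ∀ e f : ℤ, ((e + f : ℤ) : ZMod 2) = 1 → (-1 : k) ^ e + (-1 : k) ^ f = 0 := by
    intro e f h
    rw [sgn_eq (k := k) (a := e) (b := f + 1) (even_of_zmod _ ?_), ← sgn_neg]
    · ring
    · push_cast at h ⊢
      rw [← add_assoc, h]; decide
  have i1 := zmod_idem (b : ZMod 2)
  have i2 := zmod_idem (c : ZMod 2)
  have i3 := zmod_idem (d : ZMod 2)
  have i4 := zmod_idem (S : ZMod 2)
  match_scalars <;> simp only [mul_one, mul_neg, sgn_mul, sgn_neg]
  all_goals refine ev _ _ ?_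
  all_goals push_cast
  all_goals grind

lemma combine (α1 α2 α3 : k) (y z : A) (n : ℕ) (f1 f2 f3 : ℕ → A) (g1 g2 g3 : ℕ → ℕ → A)
    (c1 c2 c3 : A) :
    α1 • (y * (∑ i ∈ Finset.range n, f1 i + ∑ j ∈ Finset.range n, ∑ i ∈ Finset.range j, g1 j i + c1))
    + α2 • (∑ i ∈ Finset.range n, f2 i + ∑ j ∈ Finset.range n, ∑ i ∈ Finset.range j, g2 j i + c2)
    + α3 • ((∑ i ∈ Finset.range n, f3 i + ∑ j ∈ Finset.range n, ∑ i ∈ Finset.range j, g3 j i + c3) * z)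
    = ∑ i ∈ Finset.range n, (α1 • (y * f1 i) + α2 • f2 i + α3 • (f3 i * z))
      + ∑ j ∈ Finset.range n, ∑ i ∈ Finset.range j,
          (α1 • (y * g1 j i) + α2 • g2 j i + α3 • (g3 j i * z))
      + (α1 • (y * c1) + α2 • c2 + α3 • (c3 * z)) := by
  simp only [mul_add, add_mul, smul_add, Finset.mul_sum, Finset.sum_mul, Finset.smul_sum,
    Finset.sum_add_distrib]
  abel

lemma sum_consAt (g : ℕ → ℤ) (i j m : ℕ) (hi : i < j) (hj : j ≤ m) :
    ∑ p ∈ Finset.range m, consAt (g i + g j - 1) (removeTwo i j g) p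
      = ∑ p ∈ Finset.range (m + 1), g p - 1 := by
  induction m, hj using Nat.le_induction with
  | base =>
    obtain ⟨l, rfl⟩ : ∃ l, j = l + 1 := ⟨j - 1, by omega⟩
    rw [Finset.sum_range_succ', Finset.sum_range_succ _ (l + 1),
      sum_split g i (l + 1) hi]
    have h1 : ∑ p ∈ Finset.range l, consAt (g i + g (l + 1) - 1) (removeTwo i (l + 1) g) (p + 1)
        = ∑ p ∈ Finset.range l, removeAt i g p := by
      refine Finset.sum_congr rfl fun p hp => ?_
      have := Finset.mem_range.mp hp
      simp only [consAt, removeTwo, removeAt, Nat.add_sub_cancel, if_neg (Nat.succ_ne_zero _)]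
      split_ifs <;> first | rfl | omega
    rw [h1, sum_removeAt g i l (by omega)]
    simp only [consAt, if_true]
    ring
  | succ m hm ih =>
    rw [Finset.sum_range_succ, ih, Finset.sum_range_succ _ (m + 1)]
    have : consAt (g i + g j - 1) (removeTwo i j g) m = g (m + 1) := by
      obtain ⟨l, rfl⟩ : ∃ l, m = l + 1 := ⟨m - 1, by omega⟩
      simp only [consAt, removeTwo, Nat.add_sub_cancel, if_neg (Nat.succ_ne_zero _)]
      split_ifs <;> first | rfl | omega
    rw [this]; ring


end Helpers

/-- Lemma 4.9: commutativity of the Hochschild–Chevalley bicomplex: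
for an alternating homogeneous `k`-multilinear `n`-cochain `f` of degree `d` (`n ≥ 1`),
`d_H^{n0}(d_CH f) = d_CH^{n−1,1}(d_H^{n−1,0} f)` on homogeneous arguments. -/
theorem hochschild_chevalley_bicomplex_commutes
    (k A : Type) [Field k] [CharZero k] [Ring A] [Algebra k A]
    (𝒜 : ℤ → Submodule k A) [GradedAlgebra 𝒜]
    (G : GerstenhaberBracket k A 𝒜)
    (n : ℕ) (hn : 1 ≤ n) (d : ℤ) (F : (ℕ → ℤ) → (ℕ → A) → A)
    -- `F` only depends on the first `n` degrees and arguments: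
    (hdep : ∀ (deg deg' : ℕ → ℤ) (a a' : ℕ → A),
      (∀ p, p < n → deg p = deg' p ∧ a p = a' p) → F deg a = F deg' a')
    -- `F` is `k`-multilinear in each of its `n` argument slots:
    (hadd : ∀ (q : ℕ), q < n → ∀ (deg : ℕ → ℤ) (a : ℕ → A) (x y : A),
      F deg (Function.update a q (x + y))
        = F deg (Function.update a q x) + F deg (Function.update a q y))
    (hsmul : ∀ (q : ℕ), q < n → ∀ (deg : ℕ → ℤ) (a : ℕ → A) (c : k) (x : A),
      F deg (Function.update a q (c • x)) = c • F deg (Function.update a q x))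
    -- `F` is homogeneous of degree `d`:
    (hhom : ∀ (deg : ℕ → ℤ) (a : ℕ → A), (∀ p, p < n → a p ∈ 𝒜 (deg p)) →
      F deg a ∈ 𝒜 ((∑ p ∈ Finset.range n, deg p) + d))
    -- `F` is alternating: swapping two adjacent arguments multiplies it by
    -- `−(−1)^{(|x_q|−1)(|x_{q+1}|−1)}`:
    (halt : ∀ (q : ℕ), q + 1 < n → ∀ (deg : ℕ → ℤ) (a : ℕ → A),
      F deg a = -(((-1 : k) ^ ((deg q - 1) * (deg (q + 1) - 1))) •
        F (deg ∘ Equiv.swap q (q + 1)) (a ∘ Equiv.swap q (q + 1))))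
    (deg : ℕ → ℤ) (x : ℕ → A) (hx : ∀ p, x p ∈ 𝒜 (deg p)) :
    dHvert (k := k) (d - 1) n (dCHtop (k := k) (fun u v => G.br u v) d n F) deg x
      = dCHline (k := k) (fun u v => G.br u v) d n
          (dHvert (k := k) d (n - 1) F) deg x := by
  obtain ⟨m, rfl⟩ : ∃ m, n = m + 1 := ⟨n - 1, by omega⟩
  simp only [Nat.add_sub_cancel]
  set br : A → A → A := fun u v => G.br u v with hbr
  have hsumsub : ∀ s : Finset ℕ, ∑ p ∈ s, deg p = ∑ p ∈ s, (deg p - 1) + s.card := by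
    intro s; simp [Finset.sum_sub_distrib]
  have hL : dHvert (k := k) (d - 1) (m + 1) (dCHtop (k := k) br d (m + 1) F) deg x
      = ((-1 : k) ^ (deg (m + 1) * (d - 1 + (∑ p ∈ Finset.range (m + 1), deg p) + 1)
          + (d - 1) + ∑ p ∈ Finset.range (m + 1), deg p)) •
          (x (m + 1) * dCHtop (k := k) br d (m + 1) F (Function.update deg (m + 1) (deg (m + 2)))
            (Function.update x (m + 1) (x (m + 2))))
        + ((-1 : k) ^ (d - 1 + (∑ p ∈ Finset.range (m + 1), deg p + deg (m + 1)) + 1)) •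
          dCHtop (k := k) br d (m + 1) F (Function.update deg (m + 1) (deg (m + 1) + deg (m + 2)))
            (Function.update x (m + 1) (x (m + 1) * x (m + 2)))
        + ((-1 : k) ^ (d - 1 + (∑ p ∈ Finset.range (m + 1), deg p + deg (m + 1)))) •
          (dCHtop (k := k) br d (m + 1) F (Function.update deg (m + 1) (deg (m + 1)))
            (Function.update x (m + 1) (x (m + 1))) * x (m + 2)) := by
    unfold dHvert
    rw [Function.update_eq_self, Function.update_eq_self, Finset.sum_range_succ _ (m + 1)]
  rw [hL, top_expand (k := k) m d br F hdep halt, top_expand (k := k) m d br F hdep halt,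
    top_expand (k := k) m d br F hdep halt, combine]
  have hSn : ∑ p ∈ Finset.range (m + 1), (deg p - 1) = ∑ p ∈ Finset.range (m + 1), deg p - (m + 1) := by
    rw [hsumsub]; simp
  rw [hSn]
  simp only [hbr]
  rw [termC G (deg (m + 1)) (deg (m + 2)) d m _ _ _ _ (hx _) (hx _) (hhom deg x fun p _ => hx p), add_zero]
  unfold dCHline
  simp only [Nat.add_sub_cancel]
  rw [← Finset.sum_sub_distrib, ← Finset.sum_sub_distrib]
  congr 1
  · refine Finset.sum_congr rfl fun i hi => ?_
    rw [Finset.mem_range] at hi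
    have hSi : ∑ p ∈ Finset.range m, removeAt i deg p
        = ∑ p ∈ Finset.range i, (deg p - 1) + ∑ p ∈ Finset.Ico (i + 1) (m + 1), (deg p - 1) + m := by
      rw [sum_removeAt _ i m (by omega), hsumsub, hsumsub (Finset.Ico _ _)]
      simp only [Finset.card_range, Nat.card_Ico]
      push_cast [show i ≤ m by omega, Nat.add_sub_add_right]
      ring
    have hSS : ∑ p ∈ Finset.range (m + 1), deg p
        = ∑ p ∈ Finset.range i, (deg p - 1) + ∑ p ∈ Finset.Ico (i + 1) (m + 1), (deg p - 1)
          + deg i + m := by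
      rw [hsumsub, sum_split _ i (m + 1) hi, Finset.card_range]
      push_cast; ring
    have hmem : ∀ e u, u ∈ 𝒜 e → Tf F m deg x i e u ∈
        𝒜 (∑ p ∈ Finset.range i, (deg p - 1) + ∑ p ∈ Finset.Ico (i + 1) (m + 1), (deg p - 1)
          + m + e + d) := by
      intro e u hu
      have := hhom (Function.update (removeAt i deg) m e) (Function.update (removeAt i x) m u) ?_
      · rw [Finset.sum_range_succ, Function.update_self, Finset.sum_congr rfl
          (g := removeAt i deg) (fun p hp => Function.update_of_ne
            (by have := Finset.mem_range.mp hp; omega) _ _), hSi] at this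
        exact this
      · intro p hp
        by_cases hpm : p = m
        · subst hpm; simpa using hu
        · rw [Function.update_of_ne hpm, Function.update_of_ne hpm]
          simp only [removeAt]; split_ifs <;> exact hx _
    have hr : ∀ {α : Type} (a : ℕ → α) (p : ℕ), i ≤ p → removeAt i a p = a (p + 1) := by
      intro α a p hp
      simp only [removeAt]; rw [if_neg (by omega)]
    rw [dHvert_F (k := k) m d F hdep (removeAt i deg) (removeAt i deg) (removeAt i x) (removeAt i x)
        (deg (m + 1)) (deg (m + 2)) (x (m + 1)) (x (m + 2)) (fun _ _ => rfl) (fun _ _ => rfl)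
        (hr _ _ (by omega)) (hr _ _ (by omega)) (hr _ _ (by omega)) (hr _ _ (by omega)),
      dHvert_F (k := k) m d F hdep _ (removeAt i deg) _ (removeAt i x)
        (deg i + deg (m + 1) - 1) (deg (m + 2)) (G.br (x i) (x (m + 1))) (x (m + 2))
        (fun p hp => Function.update_of_ne (by omega) _ _)
        (fun p hp => Function.update_of_ne (by omega) _ _)
        (Function.update_self _ _ _) (Function.update_self _ _ _)
        ((Function.update_of_ne (by omega) _ _).trans (hr _ _ (by omega)))
        ((Function.update_of_ne (by omega) _ _).trans (hr _ _ (by omega))),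
      dHvert_F (k := k) m d F hdep _ (removeAt i deg) _ (removeAt i x)
        (deg (m + 1)) (deg i + deg (m + 1 + 1) - 1) (x (m + 1)) (G.br (x i) (x (m + 1 + 1)))
        (fun p hp => Function.update_of_ne (by omega) _ _)
        (fun p hp => Function.update_of_ne (by omega) _ _)
        ((Function.update_of_ne (by omega) _ _).trans (hr _ _ (by omega)))
        ((Function.update_of_ne (by omega) _ _).trans (hr _ _ (by omega)))
        (Function.update_self _ _ _) (Function.update_self _ _ _),
      hSi, hSS, Finset.sum_Ico_succ_top (show i + 1 ≤ m + 1 by omega)]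
    push_cast
    exact termA G (deg i) (deg (m + 1)) (deg (m + 2)) d m i _ _ (x i) (x (m + 1)) (x (m + 2))
      (hx _) (hx _) (hx _) (Tf F m deg x i) (fun e u v => hadd m (by omega) _ _ u v)
      (fun e s u => hsmul m (by omega) _ _ s u) (hmem _ _ (hx _)) (hmem _ _ (hx _))
  · refine Finset.sum_congr rfl fun j hj => Finset.sum_congr rfl fun i hi => ?_
    rw [Finset.mem_range] at hi hj
    have hr : ∀ {α : Type} (b : α) (a : ℕ → α) (p : ℕ), j ≤ p →
        consAt b (removeTwo i j a) p = a (p + 1) := by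
      intro α b a p hp
      obtain ⟨l, rfl⟩ : ∃ l, p = l + 1 := ⟨p - 1, by omega⟩
      simp only [consAt, removeTwo, Nat.add_sub_cancel, if_neg (Nat.succ_ne_zero _)]
      split_ifs <;> first | rfl | omega
    rw [dHvert_F (k := k) m d F hdep _ _ _ _
        (deg (m + 1)) (deg (m + 2)) (x (m + 1)) (x (m + 2)) (fun _ _ => rfl) (fun _ _ => rfl)
        (hr _ _ _ (by omega)) (hr _ _ _ (by omega)) (hr _ _ _ (by omega)) (hr _ _ _ (by omega))]
    exact termB _ _ _ _ _ (sum_consAt deg i j m hi (by omega)) _ _ _ _ _
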